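/- arXiv:1201.3986 — 6 statements merged into one kernel-verified Lean document; each statement's English description precedes it below -/
import Mathlib

section
/- Suppose the coefficients satisfy Γ(−k, l) = Γ(k, l) for all k, l ∈ G. Then for every f : G → ℝ, the total mass of the collision operator vanishes: ∑_{i ∈ G} D_Γ(f)(i) = 0. -/
/-- The discrete-velocity collision operator on `G = (ZMod M)^d`:
`D_Γ(f)(i) = ∑_{k,l ∈ G} Γ(k,l) · (f(i+k)·f(i+l) − f(i)·f(i+k+l))`. -/
def collOp {d M : ℕ} [NeZero M] (Γ : (Fin d → ZMod M) → (Fin d → ZMod M) → ℝ)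
    (f : (Fin d → ZMod M) → ℝ) (i : Fin d → ZMod M) : ℝ :=
  ∑ k : Fin d → ZMod M, ∑ l : Fin d → ZMod M,
    Γ k l * (f (i + k) * f (i + l) - f i * f (i + k + l))

/-- Summing over `i`, the gain term depends on `(k, l)` only through `l - k`. -/
theorem sum_mul_shift_eq {G R : Type*} [AddCommGroup G] [Fintype G]
    [NonUnitalNonAssocSemiring R] (f : G → R) (k l : G) :
    ∑ i, f (i + k) * f (i + l) = ∑ i, f i * f (i + (-k) + l) :=
  Fintype.sum_equiv (Equiv.addRight k) _ _ fun i => by simp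

/-- If `Γ(−k,l) = Γ(k,l)` then the total mass of the collision operator vanishes. -/
theorem collOp_sum_eq_zero (d M : ℕ) [NeZero M] (hd : 1 ≤ d) (hM : 1 ≤ M)
    (Γ : (Fin d → ZMod M) → (Fin d → ZMod M) → ℝ)
    (hΓ : ∀ k l, Γ (-k) l = Γ k l)
    (f : (Fin d → ZMod M) → ℝ) :
    ∑ i : Fin d → ZMod M, collOp Γ f i = 0 := by
  have gain : ∑ k, ∑ l, Γ k l * ∑ i, f (i + k) * f (i + l) =
      ∑ k, ∑ l, Γ k l * ∑ i, f i * f (i + k + l) :=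
    Fintype.sum_equiv (Equiv.neg _) _ _ fun k => by simp [hΓ, sum_mul_shift_eq f k]
  simp only [collOp]
  rw [Finset.sum_comm]
  simp_rw [Finset.sum_comm (s := Finset.univ) (t := Finset.univ) (f := fun i l =>
    Γ _ l * (f (i + _) * f (i + l) - f i * f (i + _ + l))), ← Finset.mul_sum,
    Finset.sum_sub_distrib, mul_sub, Finset.sum_sub_distrib]
  exact sub_eq_zero.mpr gain
end

section
/- Suppose Γ(k,l) ≥ 0 for all k, l ∈ G. Let T > 0 and let f : ℝ → (G → ℝ) be such that for every i ∈ G the map t ↦ f(t)(i) is differentiable on [0,T] with derivative equal to D_Γ(f(t))(i), and suppose f(0)(i) ≥ 0 for all i ∈ G. Then f(t)(i) ≥ 0 for all t ∈ [0,T] and all i ∈ G. -/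
open Set Filter Topology in
/-- A function with positive right derivative at a zero is positive immediately to its right. -/
lemma HasDerivWithinAt.eventually_pos_nhdsGT {g : ℝ → ℝ} {g' x : ℝ}
    (hg : HasDerivWithinAt g g' (Ioi x) x) (hx : g x = 0) (hg' : 0 < g') :
    ∀ᶠ t in 𝓝[>] x, 0 < g t := by
  have hslope := (hasDerivWithinAt_iff_tendsto_slope' self_notMem_Ioi).1 hg
  filter_upwards [hslope.eventually_const_lt hg', self_mem_nhdsWithin] with t ht hxt
  rw [slope_def_field, hx, sub_zero] at ht
  exact (div_pos_iff_of_pos_right (sub_pos.2 hxt)).1 ht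

open Set Filter Topology in
/-- The non-negative orthant is preserved by a flow whose `i`-th velocity component is at least
`-C * ε` whenever all coordinates are at least `-ε` and the `i`-th one equals `-ε`. -/
lemma nonneg_of_hasDerivWithinAt_of_quasipositive {ι : Type*} [Finite ι] {T C : ℝ}
    {f f' : ℝ → ι → ℝ}
    (hf : ∀ i, ∀ t ∈ Icc (0 : ℝ) T, HasDerivWithinAt (fun s => f s i) (f' t i) (Icc 0 T) t)
    (hf' : ∀ t ∈ Icc (0 : ℝ) T, ∀ ε > 0, (∀ j, -ε ≤ f t j) → ∀ i, f t i = -ε → -(C * ε) ≤ f' t i)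
    (h0 : ∀ i, 0 ≤ f 0 i) {t : ℝ} (ht : t ∈ Icc (0 : ℝ) T) (i : ι) : 0 ≤ f t i := by
  have barrier (δ : ℝ) (hδ : 0 < δ) :
      Icc 0 T ⊆ {s | ∀ j, 0 ≤ f s j + δ * Real.exp ((C + 1) * s)} := by
    have hderiv (j : ι) (s : ℝ) (hs : s ∈ Icc 0 T) :
        HasDerivWithinAt (fun s => f s j + δ * Real.exp ((C + 1) * s))
          (f' s j + δ * (Real.exp ((C + 1) * s) * (C + 1))) (Icc 0 T) s := by
      have hexp : HasDerivAt (fun s => δ * Real.exp ((C + 1) * s))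
          (δ * (Real.exp ((C + 1) * s) * (C + 1))) s := by
        simpa using (((hasDerivAt_id s).const_mul (C + 1)).exp).const_mul δ
      exact (hf j s hs).add hexp.hasDerivWithinAt
    refine IsClosed.Icc_subset_of_forall_exists_gt ?_ (fun j => ?_) ?_
    · have hcont : ContinuousOn (fun s j => f s j + δ * Real.exp ((C + 1) * s)) (Icc 0 T) :=
        continuousOn_pi.2 fun j s hs => (hderiv j s hs).continuousWithinAt
      rw [inter_comm]
      exact hcont.preimage_isClosed_of_isClosed isClosed_Icc (isClosed_Ici (a := 0))
    · have := h0 j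
      positivity
    · rintro x ⟨hx, hxT⟩ y hy
      have hxI : x ∈ Icc 0 T := Ico_subset_Icc_self hxT
      have hev : ∀ᶠ s in 𝓝[>] x, ∀ j, 0 < f s j + δ * Real.exp ((C + 1) * s) := by
        refine eventually_all.2 fun j => ?_
        have hd := (hderiv j x hxI).mono_of_mem_nhdsWithin
          (Icc_mem_nhdsGT_of_mem hxT)
        rcases (hx j).eq_or_lt with heq | hlt
        · refine hd.eventually_pos_nhdsGT heq.symm ?_
          have hε : 0 < δ * Real.exp ((C + 1) * x) := by positivity
          have := hf' x hxI _ hε (fun k => by linarith [hx k]) j (by linarith)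
          linarith
        · exact hd.continuousWithinAt.eventually_const_lt hlt
      obtain ⟨s, hs, hsy⟩ := (hev.and (Ioc_mem_nhdsGT hy)).exists
      exact ⟨s, fun j => (hs j).le, hsy⟩
  have hlim : Tendsto (fun δ : ℝ => f t i + δ * Real.exp ((C + 1) * t)) (𝓝[>] 0) (𝓝 (f t i)) := by
    have : Continuous fun δ : ℝ => f t i + δ * Real.exp ((C + 1) * t) := by fun_prop
    simpa using (this.tendsto 0).mono_left nhdsWithin_le_nhds
  exact ge_of_tendsto hlim (eventually_mem_nhdsWithin.mono fun δ hδ => barrier δ hδ ht i)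

/-- Products of numbers in `[-ε, B]` are bounded below by `-(B * ε)`, provided `0 ≤ B` and
`0 ≤ ε`. -/
lemma neg_mul_le_mul_of_mem_Icc {a b ε B : ℝ} (hε : 0 ≤ ε) (hB : 0 ≤ B)
    (ha : a ∈ Set.Icc (-ε) B) (hb : b ∈ Set.Icc (-ε) B) : -(B * ε) ≤ a * b := by
  obtain ⟨ha₁, ha₂⟩ := ha
  obtain ⟨hb₁, hb₂⟩ := hb
  have := mul_nonneg hB hε
  rcases le_total 0 a with h | h <;> rcases le_total 0 b with h' | h'
  · nlinarith [mul_nonneg h h']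
  · nlinarith
  · nlinarith
  · nlinarith [mul_nonneg_of_nonpos_of_nonpos h h']

/-- Lower bound for the collision operator at a coordinate where `f` attains its minimum `-ε`. -/
lemma neg_le_collOp {d M : ℕ} [NeZero M] {Γ : (Fin d → ZMod M) → (Fin d → ZMod M) → ℝ}
    (hΓ : ∀ k l, 0 ≤ Γ k l) {f : (Fin d → ZMod M) → ℝ} {B ε : ℝ} (hB : ∀ j, |f j| ≤ B)
    (hε : 0 ≤ ε) (hf : ∀ j, -ε ≤ f j) {i : Fin d → ZMod M} (hi : f i = -ε) :
    -((∑ k, ∑ l, Γ k l) * (2 * B) * ε) ≤ collOp Γ f i := by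
  have hB0 : 0 ≤ B := (abs_nonneg _).trans (hB i)
  have hmem (j) : f j ∈ Set.Icc (-ε) B := ⟨hf j, (abs_le.1 (hB j)).2⟩
  rw [collOp, mul_assoc, ← mul_neg, Finset.sum_mul]
  refine Finset.sum_le_sum fun k _ => ?_
  rw [Finset.sum_mul]
  refine Finset.sum_le_sum fun l _ => mul_le_mul_of_nonneg_left ?_ (hΓ k l)
  have hgain := neg_mul_le_mul_of_mem_Icc hε hB0 (hmem (i + k)) (hmem (i + l))
  have hloss := mul_le_mul_of_nonneg_right (abs_le.1 (hB (i + k + l))).1 hε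
  rw [hi]
  linarith

/-- If `Γ ≥ 0` and `f` solves `∂ₜ f = D_Γ(f)` on `[0,T]` with non-negative
initial data, then `f` stays non-negative on `[0,T]`. -/
theorem collOp_preserves_nonneg (d M : ℕ) [NeZero M] (hd : 1 ≤ d) (hM : 1 ≤ M)
    (Γ : (Fin d → ZMod M) → (Fin d → ZMod M) → ℝ)
    (hΓ : ∀ k l, 0 ≤ Γ k l)
    (T : ℝ) (hT : 0 < T)
    (f : ℝ → (Fin d → ZMod M) → ℝ)
    (hf : ∀ i : Fin d → ZMod M, ∀ t ∈ Set.Icc (0 : ℝ) T,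
      HasDerivWithinAt (fun s => f s i) (collOp Γ (f t) i) (Set.Icc (0 : ℝ) T) t)
    (h0 : ∀ i : Fin d → ZMod M, 0 ≤ f 0 i) :
    ∀ t ∈ Set.Icc (0 : ℝ) T, ∀ i : Fin d → ZMod M, 0 ≤ f t i := by
  have hcont : ContinuousOn f (Set.Icc 0 T) :=
    continuousOn_pi.2 fun i t ht => (hf i t ht).continuousWithinAt
  obtain ⟨B, hB⟩ := isCompact_Icc.exists_bound_of_continuousOn hcont
  intro t ht i
  exact nonneg_of_hasDerivWithinAt_of_quasipositive hf
    (fun s hs ε hε hlow j hj =>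
      neg_le_collOp hΓ (fun k => (norm_le_pi_norm (f s) k).trans (hB s hs)) hε.le hlow hj) h0 ht i
end

section
/- Suppose Γ(k,l) ≥ 0 and Γ(−k, l) = Γ(k, l) for all k, l ∈ G, and let f₀ : G → ℝ satisfy f₀(i) ≥ 0 for all i. Then there exists f : ℝ → (G → ℝ) such that: (i) f(0) = f₀; (ii) for every t ≥ 0 and every i ∈ G, the map t ↦ f(t)(i) is differentiable at t with derivative D_Γ(f(t))(i); (iii) f(t)(i) ≥ 0 for all t ≥ 0 and i ∈ G; (iv) ∑_{i ∈ G} f(t)(i) = ∑_{i ∈ G} f₀(i) for all t ≥ 0. Moreover, any two functions satisfying (i) and (ii) agree at every t ≥ 0. -/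
open Set Metric
open scoped NNReal

/-- A bounded globally Lipschitz vector field on a Banach space has global integral curves. -/
lemma LipschitzWith.exists_global_integralCurve {E : Type*} [NormedAddCommGroup E]
    [NormedSpace ℝ E] [CompleteSpace E] {F : E → E} {K L : ℝ≥0} (hF : LipschitzWith K F)
    (hL : ∀ x, ‖F x‖ ≤ L) (x₀ : E) :
    ∃ γ : ℝ → E, γ 0 = x₀ ∧ ∀ t, HasDerivAt γ (F (γ t)) t := by
  have local_sol (n : ℕ) : ∃ α : ℝ → E, α 0 = x₀ ∧
      ∀ t ∈ Ioo (-((n : ℝ) + 1)) (n + 1), HasDerivAt α (F (α t)) t := by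
    have h0 : (0 : ℝ) ∈ Icc (-((n : ℝ) + 1)) (n + 1) := ⟨by linarith [n.cast_nonneg (α := ℝ)],
      by positivity⟩
    have hPL : IsPicardLindelof (fun _ ↦ F) (⟨0, h0⟩ : Icc (-((n : ℝ) + 1)) (n + 1)) x₀
        (L * (n + 1)) 0 L K :=
      .of_time_independent (fun x _ ↦ hL x) hF.lipschitzOnWith (by simp)
    obtain ⟨α, hα0, hα⟩ := hPL.exists_eq_forall_mem_Icc_hasDerivWithinAt₀
    exact ⟨α, hα0, fun t ht ↦ (hα t (Ioo_subset_Icc_self ht)).hasDerivAt (Icc_mem_nhds ht.1 ht.2)⟩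
  choose α hα0 hα using local_sol
  have agree (m n : ℕ) (s : ℝ) (hm : |s| < m + 1) (hn : |s| < n + 1) : α m s = α n s := by
    set r : ℝ := min (m + 1) (n + 1)
    have hr : 0 < r := by positivity
    have hsub (k : ℕ) (hk : r ≤ k + 1) (t : ℝ) (ht : t ∈ Ioo (-r) r) :
        HasDerivAt (α k) (F (α k t)) t ∧ α k t ∈ univ :=
      ⟨hα k t ⟨by linarith [ht.1], by linarith [ht.2]⟩, mem_univ _⟩
    exact ODE_solution_unique_of_mem_Ioo (v := fun _ ↦ F) (s := fun _ ↦ univ)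
      (fun _ _ ↦ hF.lipschitzOnWith) (t₀ := 0) ⟨by linarith, hr⟩ (hsub m (min_le_left _ _))
      (hsub n (min_le_right _ _)) ((hα0 m).trans (hα0 n).symm) (abs_lt.mp (lt_min hm hn))
  have hceil (s : ℝ) : |s| < (⌈|s|⌉₊ : ℝ) + 1 := by linarith [Nat.le_ceil |s|]
  refine ⟨fun t ↦ α ⌈|t|⌉₊ t, hα0 _, fun t ↦ ?_⟩
  have ht := abs_lt.mp (hceil t)
  refine (hα ⌈|t|⌉₊ t ht).congr_of_eventuallyEq ?_
  filter_upwards [Ioo_mem_nhds ht.1 ht.2] with s hs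
  exact agree _ _ s (hceil s) (abs_lt.mpr hs)

/-- A real function that starts non-negative and whose derivative is non-negative wherever the
function is negative stays non-negative. -/
lemma nonneg_of_hasDerivAt_nonneg_of_neg {u u' : ℝ → ℝ} (h0 : 0 ≤ u 0)
    (hu : ∀ t, 0 ≤ t → HasDerivAt u (u' t) t) (hu' : ∀ t, 0 ≤ t → u t < 0 → 0 ≤ u' t)
    {t : ℝ} (ht : 0 ≤ t) : 0 ≤ u t := by
  have key (ε : ℝ) (hε : 0 < ε) : -u t ≤ ε * (1 + t) := by
    refine image_le_of_deriv_right_lt_deriv_boundary' (f := fun s ↦ -u s) (f' := fun s ↦ -u' s)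
      (B := fun s ↦ ε * (1 + s)) (B' := fun _ ↦ ε) (a := 0) (b := t)
      (HasDerivAt.continuousOn fun s hs ↦ (hu s hs.1).neg)
      (fun s hs ↦ (hu s hs.1).neg.hasDerivWithinAt) (by linarith) (by fun_prop)
      (fun s _ ↦ ?_) (fun s hs hsB ↦ ?_) ⟨ht, le_rfl⟩
    · simpa using (((hasDerivAt_id s).const_add 1).const_mul ε).hasDerivWithinAt
    · have : 0 < ε * (1 + s) := mul_pos hε (by linarith [hs.1])
      linarith [hu' s hs.1 (by linarith)]
  by_contra! hneg
  have h1 : 0 < 1 + t := by linarith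
  have := key (-u t / (2 * (1 + t))) (div_pos (by linarith) (by linarith))
  have h2 : -u t / (2 * (1 + t)) * (1 + t) = -u t / 2 := by field_simp
  linarith

/-- A `C¹` vector field on `ℝ^ι` is Lipschitz on each closed ball. -/
lemma ContDiff.exists_lipschitzOnWith_closedBall {ι : Type*} [Fintype ι]
    {V : (ι → ℝ) → ι → ℝ} (hV : ContDiff ℝ 1 V) (R : ℝ) :
    ∃ K, LipschitzOnWith K V (closedBall 0 R) :=
  hV.contDiffOn.exists_lipschitzOnWith one_ne_zero (convex_closedBall _ _)
    (isCompact_closedBall _ _)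

/-- A quasi-positive, mass-preserving `C¹` vector field on `ℝ^ι` has a global non-negative
mass-conserving integral curve from each non-negative initial point. -/
lemma ContDiff.exists_nonneg_integralCurve {ι : Type*} [Fintype ι] {V : (ι → ℝ) → ι → ℝ}
    (hV : ContDiff ℝ 1 V) (hpos : ∀ x i, (∀ j, 0 ≤ x j) → x i = 0 → 0 ≤ V x i)
    (hmass : ∀ x, ∑ i, V x i = 0) {x₀ : ι → ℝ} (hx₀ : ∀ i, 0 ≤ x₀ i) :
    ∃ γ : ℝ → ι → ℝ, γ 0 = x₀ ∧ (∀ t, 0 ≤ t → HasDerivAt γ (V (γ t)) t) ∧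
      (∀ t, 0 ≤ t → ∀ i, 0 ≤ γ t i) ∧ ∀ t, 0 ≤ t → ∑ i, γ t i = ∑ i, x₀ i := by
  set S := ∑ i, x₀ i
  have hS : 0 ≤ S := Finset.sum_nonneg fun i _ ↦ hx₀ i
  -- Truncating the argument to the box `[0, S]^ι` makes the field bounded and Lipschitz.
  let P : (ι → ℝ) → ι → ℝ := fun x i ↦ max 0 (min S (x i))
  have hP : LipschitzWith 1 P := LipschitzWith.of_dist_le_mul fun x y ↦ by
    rw [NNReal.coe_one, one_mul, dist_pi_le_iff dist_nonneg]
    intro i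
    have h := ((LipschitzWith.id (α := ℝ)).const_min S |>.const_max 0).dist_le_mul (x i) (y i)
    simp only [NNReal.coe_one, one_mul, id] at h
    exact h.trans (dist_le_pi_dist x y i)
  have hPball (x) : P x ∈ closedBall (0 : ι → ℝ) S := by
    rw [mem_closedBall_zero_iff, pi_norm_le_iff_of_nonneg hS]
    intro i
    rw [Real.norm_of_nonneg (le_max_left _ _)]
    exact max_le hS (min_le_left _ _)
  obtain ⟨K, hK⟩ := hV.exists_lipschitzOnWith_closedBall S
  obtain ⟨L, hL⟩ := (isCompact_closedBall (0 : ι → ℝ) S).exists_bound_of_continuousOn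
    hV.continuous.continuousOn
  have hF : LipschitzWith (K * 1) (V ∘ P) :=
    lipschitzOnWith_univ.mp (hK.comp hP.lipschitzOnWith fun x _ ↦ hPball x)
  obtain ⟨γ, hγ0, hγ⟩ := hF.exists_global_integralCurve (L := L.toNNReal)
    (fun x ↦ (hL _ (hPball x)).trans (Real.le_coe_toNNReal L)) x₀
  have hγi (t i) : HasDerivAt (fun s ↦ γ s i) (V (P (γ t)) i) t := hasDerivAt_pi.mp (hγ t) i
  have hsum (t : ℝ) : ∑ i, γ t i = S := by
    have hd (s : ℝ) : HasDerivAt (fun s ↦ ∑ i, γ s i) 0 s := by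
      simpa only [hmass] using HasDerivAt.fun_sum fun i (_ : i ∈ Finset.univ) ↦ hγi s i
    have := is_const_of_deriv_eq_zero (fun s ↦ (hd s).differentiableAt) (fun s ↦ (hd s).deriv) t 0
    simpa [hγ0] using this
  have hnonneg (t : ℝ) (ht : 0 ≤ t) (i : ι) : 0 ≤ γ t i := by
    refine nonneg_of_hasDerivAt_nonneg_of_neg (u := fun s ↦ γ s i) (by simpa [hγ0] using hx₀ i)
      (fun s _ ↦ hγi s i) (fun s _ hs ↦ ?_) ht
    exact hpos _ i (fun j ↦ le_max_left _ _) (max_eq_left ((min_le_right _ _).trans hs.le))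
  refine ⟨γ, hγ0, fun t ht ↦ ?_, hnonneg, fun t _ ↦ hsum t⟩
  have hPγ : P (γ t) = γ t := funext fun i ↦ by
    have : γ t i ≤ S := hsum t ▸
      Finset.single_le_sum (fun j _ ↦ hnonneg t ht j) (Finset.mem_univ i)
    simp [P, hnonneg t ht i, this]
  simpa [hPγ] using hγ t

/-- Two forward integral curves of a `C¹` vector field on `ℝ^ι` with the same initial point
agree for all non-negative times. -/
lemma ContDiff.integralCurve_unique {ι : Type*} [Fintype ι] {V : (ι → ℝ) → ι → ℝ}
    (hV : ContDiff ℝ 1 V) {g h : ℝ → ι → ℝ} (h0 : g 0 = h 0)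
    (hg : ∀ t, 0 ≤ t → HasDerivAt g (V (g t)) t) (hh : ∀ t, 0 ≤ t → HasDerivAt h (V (h t)) t)
    {t : ℝ} (ht : 0 ≤ t) : g t = h t := by
  have hgc : ContinuousOn g (Icc 0 t) := HasDerivAt.continuousOn fun s hs ↦ hg s hs.1
  have hhc : ContinuousOn h (Icc 0 t) := HasDerivAt.continuousOn fun s hs ↦ hh s hs.1
  obtain ⟨R, hR⟩ := isCompact_Icc.exists_bound_of_continuousOn hgc
  obtain ⟨R', hR'⟩ := isCompact_Icc.exists_bound_of_continuousOn hhc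
  obtain ⟨K, hK⟩ := hV.exists_lipschitzOnWith_closedBall (max R R')
  exact ODE_solution_unique_of_mem_Icc_right (v := fun _ ↦ V) (s := fun _ ↦ closedBall 0 (max R R'))
    (fun _ _ ↦ hK)
    hgc (fun s hs ↦ (hg s hs.1).hasDerivWithinAt) (fun s hs ↦ mem_closedBall_zero_iff.mpr
      ((hR s (Ico_subset_Icc_self hs)).trans (le_max_left _ _)))
    hhc (fun s hs ↦ (hh s hs.1).hasDerivWithinAt) (fun s hs ↦ mem_closedBall_zero_iff.mpr
      ((hR' s (Ico_subset_Icc_self hs)).trans (le_max_right _ _)))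
    h0 ⟨ht, le_rfl⟩

lemma contDiff_collOp {d M : ℕ} [NeZero M] (Γ : (Fin d → ZMod M) → (Fin d → ZMod M) → ℝ) :
    ContDiff ℝ 1 (collOp Γ) := by
  rw [contDiff_pi]
  intro i
  unfold collOp
  fun_prop

/-- The collision operator with non-negative coefficients is quasi-positive. -/
lemma collOp_nonneg_of_eq_zero {d M : ℕ} [NeZero M]
    {Γ : (Fin d → ZMod M) → (Fin d → ZMod M) → ℝ} (hΓ : ∀ k l, 0 ≤ Γ k l)
    (f : (Fin d → ZMod M) → ℝ) (i : Fin d → ZMod M) (hf : ∀ j, 0 ≤ f j) (hi : f i = 0) :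
    0 ≤ collOp Γ f i := by
  refine Finset.sum_nonneg fun k _ ↦ Finset.sum_nonneg fun l _ ↦ mul_nonneg (hΓ k l) ?_
  simpa [hi] using mul_nonneg (hf (i + k)) (hf (i + l))

/-- The collision operator with coefficients even in the first variable preserves mass. -/
lemma sum_collOp_eq_zero {d M : ℕ} [NeZero M]
    {Γ : (Fin d → ZMod M) → (Fin d → ZMod M) → ℝ} (hΓ : ∀ k l, Γ (-k) l = Γ k l)
    (f : (Fin d → ZMod M) → ℝ) : ∑ i, collOp Γ f i = 0 := by
  have swap (k l : Fin d → ZMod M) :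
      ∑ i, f (i + k) * f (i + l) = ∑ i, f i * f (i + -k + l) :=
    Fintype.sum_equiv (Equiv.addRight k) _ _ fun i ↦ by simp
  have reflect : ∑ k, ∑ l, Γ k l * ∑ i, f i * f (i + -k + l) =
      ∑ k, ∑ l, Γ k l * ∑ i, f i * f (i + k + l) :=
    Fintype.sum_equiv (Equiv.neg _) _ _ fun k ↦ by simp [hΓ]
  have expand : ∑ i, collOp Γ f i =
      ∑ k, ∑ l, Γ k l * (∑ i, f (i + k) * f (i + l) - ∑ i, f i * f (i + k + l)) := by
    simp only [collOp, ← Finset.sum_sub_distrib, Finset.mul_sum]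
    rw [Finset.sum_comm]
    exact Finset.sum_congr rfl fun k _ ↦ Finset.sum_comm
  simp only [expand, swap, mul_sub, Finset.sum_sub_distrib, reflect, sub_self]

/-- Global well-posedness of `∂ₜ f = D_Γ(f)` for non-negative symmetric `Γ` and
non-negative initial data: existence of a global non-negative mass-conserving
solution, and uniqueness for `t ≥ 0`. -/
theorem collOp_global_wellposedness (d M : ℕ) [NeZero M] (hd : 1 ≤ d) (hM : 1 ≤ M)
    (Γ : (Fin d → ZMod M) → (Fin d → ZMod M) → ℝ)
    (hΓpos : ∀ k l, 0 ≤ Γ k l)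
    (hΓsym : ∀ k l, Γ (-k) l = Γ k l)
    (f₀ : (Fin d → ZMod M) → ℝ)
    (hf₀ : ∀ i, 0 ≤ f₀ i) :
    (∃ f : ℝ → (Fin d → ZMod M) → ℝ,
      f 0 = f₀ ∧
      (∀ t : ℝ, 0 ≤ t → ∀ i : Fin d → ZMod M,
        HasDerivAt (fun s => f s i) (collOp Γ (f t) i) t) ∧
      (∀ t : ℝ, 0 ≤ t → ∀ i : Fin d → ZMod M, 0 ≤ f t i) ∧
      (∀ t : ℝ, 0 ≤ t →
        ∑ i : Fin d → ZMod M, f t i = ∑ i : Fin d → ZMod M, f₀ i)) ∧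
    (∀ g h : ℝ → (Fin d → ZMod M) → ℝ,
      g 0 = f₀ → h 0 = f₀ →
      (∀ t : ℝ, 0 ≤ t → ∀ i : Fin d → ZMod M,
        HasDerivAt (fun s => g s i) (collOp Γ (g t) i) t) →
      (∀ t : ℝ, 0 ≤ t → ∀ i : Fin d → ZMod M,
        HasDerivAt (fun s => h s i) (collOp Γ (h t) i) t) →
      ∀ t : ℝ, 0 ≤ t → g t = h t) := by
  have hC := contDiff_collOp Γ
  refine ⟨?_, fun g h hg0 hh0 hg hh t ht ↦ ?_⟩
  · obtain ⟨f, hf0, hf, hnonneg, hmass⟩ := hC.exists_nonneg_integralCurve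
      (collOp_nonneg_of_eq_zero hΓpos) (sum_collOp_eq_zero hΓsym) hf₀
    exact ⟨f, hf0, fun t ht ↦ hasDerivAt_pi.mp (hf t ht), hnonneg, hmass⟩
  · exact hC.integralCurve_unique (hg0.trans hh0.symm) (fun s hs ↦ hasDerivAt_pi.mpr (hg s hs))
      (fun s hs ↦ hasDerivAt_pi.mpr (hh s hs)) ht
end

section
/- Suppose Γ(−k, l) = Γ(k, l) and Γ(k, l) = Γ(l, k) for all k, l ∈ G. Then for all f, φ : G → ℝ the discrete weak form holds: ∑_{i ∈ G} D_Γ(f)(i) · φ(i) = (1/2) · ∑_{i ∈ G} ∑_{k ∈ G} ∑_{l ∈ G} Γ(k,l) · f(i) · f(i+k+l) · (φ(i+k) + φ(i+l) − φ(i+k+l) − φ(i)). -/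
section Symmetries

variable {G : Type*} [AddCommGroup G] [Fintype G] {Γ : G → G → ℝ}

/-- Invariance of collision sums under the shift `i ↦ i + k` combined with `k ↦ -k`. -/
theorem sum_collision_reflect (hΓ : ∀ k l, Γ (-k) l = Γ k l) (F : G → G → G → G → ℝ) :
    ∑ i, ∑ k, ∑ l, Γ k l * F i (i + k) (i + l) (i + k + l) =
      ∑ i, ∑ k, ∑ l, Γ k l * F (i + k) i (i + k + l) (i + l) := by
  rw [Finset.sum_comm, Finset.sum_comm (γ := G) (f := fun i k => ∑ l, Γ k l * _)]
  rw [← Equiv.sum_comp (Equiv.neg G)]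
  refine Finset.sum_congr rfl fun k _ => ?_
  rw [← Equiv.sum_comp (Equiv.addRight k)]
  simp [hΓ]

/-- Invariance of collision sums under the exchange of `k` and `l`. -/
theorem sum_collision_swap (hΓ : ∀ k l, Γ k l = Γ l k) (F : G → G → G → G → ℝ) :
    ∑ i, ∑ k, ∑ l, Γ k l * F i (i + k) (i + l) (i + k + l) =
      ∑ i, ∑ k, ∑ l, Γ k l * F i (i + l) (i + k) (i + k + l) := by
  refine Finset.sum_congr rfl fun i _ => ?_
  rw [Finset.sum_comm]
  refine Finset.sum_congr rfl fun k _ => Finset.sum_congr rfl fun l _ => ?_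
  rw [hΓ l k, add_right_comm i l k]

end Symmetries

/-- The discrete weak form of the collision operator. -/
theorem collOp_weak_form (d M : ℕ) [NeZero M] (hd : 1 ≤ d) (hM : 1 ≤ M)
    (Γ : (Fin d → ZMod M) → (Fin d → ZMod M) → ℝ)
    (hΓ₁ : ∀ k l, Γ (-k) l = Γ k l)
    (hΓ₂ : ∀ k l, Γ k l = Γ l k)
    (f φ : (Fin d → ZMod M) → ℝ) :
    ∑ i : Fin d → ZMod M, collOp Γ f i * φ i =
      (1 / 2) * ∑ i : Fin d → ZMod M, ∑ k : Fin d → ZMod M, ∑ l : Fin d → ZMod M,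
        Γ k l * f i * f (i + k + l) *
          (φ (i + k) + φ (i + l) - φ (i + k + l) - φ i) := by
  have gain : ∑ i, ∑ k, ∑ l, Γ k l * (f (i + k) * f (i + l) * φ i) =
      ∑ i, ∑ k, ∑ l, Γ k l * (f i * f (i + k + l) * φ (i + k)) :=
    sum_collision_reflect hΓ₁ fun a b c _ => f b * f c * φ a
  have gain_swap : ∑ i, ∑ k, ∑ l, Γ k l * (f i * f (i + k + l) * φ (i + k)) =
      ∑ i, ∑ k, ∑ l, Γ k l * (f i * f (i + k + l) * φ (i + l)) :=
    sum_collision_swap hΓ₂ fun a b _ d => f a * f d * φ b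
  have loss : ∑ i, ∑ k, ∑ l, Γ k l * (f i * f (i + k + l) * φ i) =
      ∑ i, ∑ k, ∑ l, Γ k l * (f i * f (i + k + l) * φ (i + k + l)) :=
    calc
      _ = ∑ i, ∑ k, ∑ l, Γ k l * (f (i + k) * f (i + l) * φ (i + k)) :=
        sum_collision_reflect hΓ₁ fun a _ _ d => f a * f d * φ a
      _ = ∑ i, ∑ k, ∑ l, Γ k l * (f (i + l) * f (i + k) * φ (i + l)) :=
        sum_collision_swap hΓ₂ fun _ b c _ => f b * f c * φ b
      _ = ∑ i, ∑ k, ∑ l, Γ k l * (f (i + k + l) * f i * φ (i + k + l)) :=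
        sum_collision_reflect hΓ₁ fun _ b c _ => f c * f b * φ c
      _ = _ := by simp only [mul_comm (f (_ + _ + _))]
  have lhs : ∑ i, collOp Γ f i * φ i =
      ∑ i, ∑ k, ∑ l, Γ k l * (f (i + k) * f (i + l) * φ i) -
        ∑ i, ∑ k, ∑ l, Γ k l * (f i * f (i + k + l) * φ i) := by
    simp only [collOp, Finset.sum_mul, ← Finset.sum_sub_distrib]
    refine Finset.sum_congr rfl fun i _ => Finset.sum_congr rfl fun k _ =>
      Finset.sum_congr rfl fun l _ => ?_
    ring
  have rhs : ∑ i, ∑ k, ∑ l, Γ k l * f i * f (i + k + l) *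
        (φ (i + k) + φ (i + l) - φ (i + k + l) - φ i) =
      ∑ i, ∑ k, ∑ l, Γ k l * (f i * f (i + k + l) * φ (i + k)) +
        ∑ i, ∑ k, ∑ l, Γ k l * (f i * f (i + k + l) * φ (i + l)) -
        ∑ i, ∑ k, ∑ l, Γ k l * (f i * f (i + k + l) * φ (i + k + l)) -
        ∑ i, ∑ k, ∑ l, Γ k l * (f i * f (i + k + l) * φ i) := by
    simp only [← Finset.sum_sub_distrib, ← Finset.sum_add_distrib]
    refine Finset.sum_congr rfl fun i _ => Finset.sum_congr rfl fun k _ =>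
      Finset.sum_congr rfl fun l _ => ?_
    ring
  rw [lhs, rhs]
  linarith
end

section
/- Suppose Γ(k,l) ≥ 0, Γ(−k, l) = Γ(k, l) and Γ(k, l) = Γ(l, k) for all k, l ∈ G. Then for every f : G → ℝ with f(i) > 0 for all i ∈ G, the discrete H-theorem holds: ∑_{i ∈ G} D_Γ(f)(i) · log f(i) ≤ 0. -/
section Symmetrization

variable {G : Type*} [AddCommGroup G] [Fintype G]

theorem sum_sum_sum_neg_add_left (T : G → G → G → ℝ) :
    ∑ k, ∑ l, ∑ i, T (-k) l (i + k) = ∑ k, ∑ l, ∑ i, T k l i := by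
  rw [← Equiv.sum_comp (Equiv.neg G) fun k => ∑ l, ∑ i, T k l i]
  refine Finset.sum_congr rfl fun k _ => Finset.sum_congr rfl fun l _ => ?_
  exact Equiv.sum_comp (Equiv.addRight k) (T (-k) l)

theorem sum_sum_sum_neg_add_right (T : G → G → G → ℝ) :
    ∑ k, ∑ l, ∑ i, T k (-l) (i + l) = ∑ k, ∑ l, ∑ i, T k l i := by
  rw [Finset.sum_comm, Finset.sum_comm (f := fun k l => ∑ i, T k l i)]
  exact sum_sum_sum_neg_add_left fun l k => T k l

theorem mul_sub_mul_log_nonpos {a b c e : ℝ} (ha : 0 < a) (hb : 0 < b) (hc : 0 < c)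
    (he : 0 < e) :
    (a * b - c * e) * (Real.log c - Real.log a - Real.log b + Real.log e) ≤ 0 := by
  have hlog : Real.log c - Real.log a - Real.log b + Real.log e =
      Real.log (c * e) - Real.log (a * b) := by
    rw [Real.log_mul hc.ne' he.ne', Real.log_mul ha.ne' hb.ne']
    ring
  rw [hlog]
  rcases le_total (a * b) (c * e) with h | h
  · exact mul_nonpos_of_nonpos_of_nonneg (sub_nonpos.2 h)
      (sub_nonneg.2 (Real.log_le_log (mul_pos ha hb) h))
  · exact mul_nonpos_of_nonneg_of_nonpos (sub_nonneg.2 h)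
      (sub_nonpos.2 (Real.log_le_log (mul_pos hc he) h))

/-- Symmetrized weak form of the collision operator, tested against `g`. -/
theorem four_mul_sum_collision (Γ : G → G → ℝ) (hΓ₁ : ∀ k l, Γ (-k) l = Γ k l)
    (hΓ₂ : ∀ k l, Γ k (-l) = Γ k l) (f g : G → ℝ) :
    4 * ∑ k, ∑ l, ∑ i, Γ k l * (f (i + k) * f (i + l) - f i * f (i + k + l)) * g i =
      ∑ k, ∑ l, ∑ i, Γ k l * ((f (i + k) * f (i + l) - f i * f (i + k + l)) *
        (g i - g (i + k) - g (i + l) + g (i + k + l))) := by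
  let T (k l i : G) : ℝ := Γ k l * (f (i + k) * f (i + l) - f i * f (i + k + l)) * g i
  have hk := sum_sum_sum_neg_add_left T
  have hl := sum_sum_sum_neg_add_right T
  have hkl := (sum_sum_sum_neg_add_right fun k l i => T (-k) l (i + k)).trans hk
  have hsum : 4 * ∑ k, ∑ l, ∑ i, T k l i = ∑ k, ∑ l, ∑ i,
      (T k l i + T (-k) l (i + k) + T k (-l) (i + l) + T (-k) (-l) (i + l + k)) := by
    simp only [Finset.sum_add_distrib, hk, hl, hkl]
    ring
  refine hsum.trans <| Finset.sum_congr rfl fun k _ => Finset.sum_congr rfl fun l _ =>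
    Finset.sum_congr rfl fun i _ => ?_
  have h₁ : i + l + k + -k = i + l := by abel
  have h₂ : i + l + k + -l = i + k := by abel
  have h₃ : i + l + -l = i := by abel
  have h₄ : i + k + -k = i := by abel
  have h₅ : i + k + l = i + l + k := by abel
  simp only [T, hΓ₁, hΓ₂, h₁, h₂, h₃, h₄, h₅]
  ring

end Symmetrization

/-- The discrete H-theorem: `∑_i D_Γ(f)(i) log f(i) ≤ 0`. -/
theorem collOp_H_theorem (d M : ℕ) [NeZero M] (hd : 1 ≤ d) (hM : 1 ≤ M)
    (Γ : (Fin d → ZMod M) → (Fin d → ZMod M) → ℝ)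
    (hΓpos : ∀ k l, 0 ≤ Γ k l)
    (hΓ₁ : ∀ k l, Γ (-k) l = Γ k l)
    (hΓ₂ : ∀ k l, Γ k l = Γ l k)
    (f : (Fin d → ZMod M) → ℝ)
    (hf : ∀ i, 0 < f i) :
    ∑ i : Fin d → ZMod M, collOp Γ f i * Real.log (f i) ≤ 0 := by
  have hΓ₃ : ∀ k l, Γ k (-l) = Γ k l := fun k l => by rw [hΓ₂, hΓ₁, hΓ₂]
  have hweak : ∑ i, collOp Γ f i * Real.log (f i) = ∑ k, ∑ l, ∑ i,
      Γ k l * (f (i + k) * f (i + l) - f i * f (i + k + l)) * Real.log (f i) := by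
    simp only [collOp, Finset.sum_mul]
    rw [Finset.sum_comm]
    exact Finset.sum_congr rfl fun k _ => Finset.sum_comm
  have hnonpos : 4 * ∑ i, collOp Γ f i * Real.log (f i) ≤ 0 := by
    rw [hweak, four_mul_sum_collision Γ hΓ₁ hΓ₃ f fun i => Real.log (f i)]
    exact Finset.sum_nonpos fun k _ => Finset.sum_nonpos fun l _ => Finset.sum_nonpos fun i _ =>
      mul_nonpos_of_nonneg_of_nonpos (hΓpos k l)
        (mul_sub_mul_log_nonpos (hf _) (hf _) (hf _) (hf _))
  linarith
end

section
/- For every Γ : G × G → ℂ, every f : G → ℂ and every I ∈ G, the discrete Fourier transform of the collision operator satisfies the convolution identity: (D_Γ(f))^(I) = ∑_{K, L ∈ G with K + L = I} (β(K,L) − β(L,L)) · f̂(K) · f̂(L), where β(K,L) = ∑_{k ∈ G} ∑_{l ∈ G} Γ(k,l) · e(K·k) · e(L·l). -/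
/-- The discrete-velocity collision operator (complex version) on `G = (ZMod M)^d`:
`D_Γ(f)(i) = ∑_{k,l ∈ G} Γ(k,l) · (f(i+k)·f(i+l) − f(i)·f(i+k+l))`. -/
noncomputable def collOpC {d M : ℕ} [NeZero M] (Γ : (Fin d → ZMod M) → (Fin d → ZMod M) → ℂ)
    (f : (Fin d → ZMod M) → ℂ) (i : Fin d → ZMod M) : ℂ :=
  ∑ k : Fin d → ZMod M, ∑ l : Fin d → ZMod M,
    Γ k l * (f (i + k) * f (i + l) - f i * f (i + k + l))

/-- The character `e(m) = exp(2πi·m/M)` on `ZMod M`. -/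
noncomputable def zmodChar {M : ℕ} (m : ZMod M) : ℂ :=
  Complex.exp (2 * Real.pi * Complex.I * (m.val : ℂ) / (M : ℂ))

/-- The pairing `K·i = ∑_j K_j i_j ∈ ZMod M`. -/
def zmodPairing {d M : ℕ} (K i : Fin d → ZMod M) : ZMod M :=
  ∑ j : Fin d, K j * i j

/-- The discrete Fourier transform `f̂(K) = M^{−d} ∑_i f(i) e(−K·i)`. -/
noncomputable def dft {d M : ℕ} [NeZero M] (f : (Fin d → ZMod M) → ℂ)
    (K : Fin d → ZMod M) : ℂ :=
  ((M : ℂ) ^ d)⁻¹ * ∑ i : Fin d → ZMod M, f i * zmodChar (-(zmodPairing K i))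

/-- The kernel modes `β(K,L) = ∑_{k,l} Γ(k,l) e(K·k) e(L·l)`. -/
noncomputable def kernelMode {d M : ℕ} [NeZero M]
    (Γ : (Fin d → ZMod M) → (Fin d → ZMod M) → ℂ)
    (K L : Fin d → ZMod M) : ℂ :=
  ∑ k : Fin d → ZMod M, ∑ l : Fin d → ZMod M,
    Γ k l * zmodChar (zmodPairing K k) * zmodChar (zmodPairing L l)

theorem zmodChar_eq_stdAddChar {M : ℕ} [NeZero M] (m : ZMod M) :
    zmodChar m = ZMod.stdAddChar m := by
  rw [ZMod.stdAddChar_apply, ZMod.toCircle_apply, zmodChar]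

theorem zmodChar_add {M : ℕ} [NeZero M] (a b : ZMod M) :
    zmodChar (a + b) = zmodChar a * zmodChar b := by
  simp only [zmodChar_eq_stdAddChar, AddChar.map_add_eq_mul]

theorem zmodPairing_add_right {d M : ℕ} (K i j : Fin d → ZMod M) :
    zmodPairing K (i + j) = zmodPairing K i + zmodPairing K j :=
  dotProduct_add K i j

theorem zmodPairing_sub_left {d M : ℕ} (K L i : Fin d → ZMod M) :
    zmodPairing (K - L) i = zmodPairing K i - zmodPairing L i :=
  sub_dotProduct K L i

theorem zmodPairing_sub_right {d M : ℕ} (K i j : Fin d → ZMod M) :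
    zmodPairing K (i - j) = zmodPairing K i - zmodPairing K j :=
  dotProduct_sub K i j

/-- Orthogonality of the characters of `(ZMod M)^d`. -/
theorem sum_zmodChar_zmodPairing {d M : ℕ} [NeZero M] (j : Fin d → ZMod M) :
    ∑ K : Fin d → ZMod M, zmodChar (zmodPairing K j) = if j = 0 then (M : ℂ) ^ d else 0 := by
  have hprod (K : Fin d → ZMod M) :
      zmodChar (zmodPairing K j) = ∏ t, (ZMod.stdAddChar (K t * j t) : ℂ) := by
    rw [zmodChar_eq_stdAddChar, zmodPairing]
    exact map_prod ZMod.stdAddChar.toMonoidHom (fun t => Multiplicative.ofAdd (K t * j t)) _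
  simp_rw [hprod]
  rw [← Fintype.prod_sum fun t (a : ZMod M) => (ZMod.stdAddChar (a * j t) : ℂ)]
  simp_rw [AddChar.sum_mulShift _ (ZMod.isPrimitive_stdAddChar M)]
  split_ifs with h
  · simp [h, ZMod.card]
  · obtain ⟨t, ht⟩ := Function.ne_iff.mp h
    exact Finset.prod_eq_zero (Finset.mem_univ t) (mod_cast if_neg ht)

/-- A translation becomes a modulation under the discrete Fourier transform. -/
theorem dft_comp_add_right {d M : ℕ} [NeZero M] (f : (Fin d → ZMod M) → ℂ)
    (k K : Fin d → ZMod M) :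
    dft (fun i => f (i + k)) K = zmodChar (zmodPairing K k) * dft f K := by
  rw [dft, dft, mul_left_comm, Finset.mul_sum _ _ (zmodChar _)]
  congr 1
  refine Fintype.sum_equiv (Equiv.addRight k) _ _ fun i => ?_
  rw [Equiv.coe_addRight, mul_left_comm, ← zmodChar_add, zmodPairing_add_right]
  congr 2
  ring

/-- The discrete Fourier transform of a product is the convolution of the transforms. -/
theorem dft_mul {d M : ℕ} [NeZero M] (f g : (Fin d → ZMod M) → ℂ) (I : Fin d → ZMod M) :
    dft (fun i => f i * g i) I =
      ∑ p ∈ Finset.univ.filter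
          (fun p : (Fin d → ZMod M) × (Fin d → ZMod M) => p.1 + p.2 = I),
        dft f p.1 * dft g p.2 := by
  have hM : (M : ℂ) ^ d ≠ 0 := pow_ne_zero _ (NeZero.ne _)
  have hchar (K i j : Fin d → ZMod M) :
      zmodChar (-(zmodPairing K i)) * zmodChar (-(zmodPairing (I - K) j)) =
        zmodChar (-(zmodPairing I j)) * zmodChar (zmodPairing K (j - i)) := by
    rw [← zmodChar_add, ← zmodChar_add, zmodPairing_sub_left, zmodPairing_sub_right]
    congr 1
    ring
  symm
  calc
    _ = ∑ K, dft f K * dft g (I - K) := by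
      refine Finset.sum_bij' (fun p _ => p.1) (fun K _ => (K, I - K)) ?_ ?_ ?_ ?_ ?_ <;>
        simp +contextual [eq_comm]
    _ = ∑ K, ((M : ℂ) ^ d)⁻¹ * ((M : ℂ) ^ d)⁻¹ * ∑ i, ∑ j, f i * g j *
          (zmodChar (-(zmodPairing I j)) * zmodChar (zmodPairing K (j - i))) := by
      refine Finset.sum_congr rfl fun K _ => ?_
      rw [dft, dft, mul_mul_mul_comm, Finset.sum_mul_sum]
      simp_rw [← hchar, mul_mul_mul_comm]
    _ = ((M : ℂ) ^ d)⁻¹ * ((M : ℂ) ^ d)⁻¹ * ∑ i, ∑ j, f i * g j *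
          (zmodChar (-(zmodPairing I j)) * ∑ K, zmodChar (zmodPairing K (j - i))) := by
      rw [← Finset.mul_sum, Finset.sum_comm]
      congr 1
      refine Finset.sum_congr rfl fun i _ => ?_
      rw [Finset.sum_comm]
      simp_rw [Finset.mul_sum]
    _ = dft (fun i => f i * g i) I := by
      simp only [sum_zmodChar_zmodPairing, sub_eq_zero, mul_ite, mul_zero, Finset.sum_ite_eq',
        Finset.mem_univ, if_true]
      rw [dft, mul_assoc]
      congr 1
      rw [Finset.mul_sum]
      refine Finset.sum_congr rfl fun i _ => ?_
      field_simp

theorem dft_sub {d M : ℕ} [NeZero M] (f g : (Fin d → ZMod M) → ℂ) (I : Fin d → ZMod M) :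
    dft (fun i => f i - g i) I = dft f I - dft g I := by
  simp only [dft, sub_mul, Finset.sum_sub_distrib, mul_sub]

theorem dft_const_mul {d M : ℕ} [NeZero M] (c : ℂ) (f : (Fin d → ZMod M) → ℂ)
    (I : Fin d → ZMod M) : dft (fun i => c * f i) I = c * dft f I := by
  simp only [dft, mul_assoc, ← Finset.mul_sum, mul_left_comm]

theorem dft_sum {d M : ℕ} [NeZero M] {ι : Type*} (s : Finset ι)
    (f : ι → (Fin d → ZMod M) → ℂ) (I : Fin d → ZMod M) :
    dft (fun i => ∑ a ∈ s, f a i) I = ∑ a ∈ s, dft (f a) I := by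
  simp only [dft, Finset.sum_mul, ← Finset.mul_sum]
  rw [Finset.sum_comm]

/-- The Fourier transform of the collision operator is a weighted convolution:
`(D_Γ f)^(I) = ∑_{K+L=I} (β(K,L) − β(L,L)) f̂(K) f̂(L)`. -/
theorem dft_collOpC (d M : ℕ) [NeZero M] (hd : 1 ≤ d) (hM : 1 ≤ M)
    (Γ : (Fin d → ZMod M) → (Fin d → ZMod M) → ℂ)
    (f : (Fin d → ZMod M) → ℂ) (I : Fin d → ZMod M) :
    dft (collOpC Γ f) I =
      ∑ p ∈ Finset.univ.filter
          (fun p : (Fin d → ZMod M) × (Fin d → ZMod M) => p.1 + p.2 = I),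
        (kernelMode Γ p.1 p.2 - kernelMode Γ p.2 p.2) * dft f p.1 * dft f p.2 := by
  have hsum : dft (collOpC Γ f) I =
      ∑ k, ∑ l, Γ k l * ∑ p ∈ Finset.univ.filter
          (fun p : (Fin d → ZMod M) × (Fin d → ZMod M) => p.1 + p.2 = I),
        (zmodChar (zmodPairing p.1 k) * zmodChar (zmodPairing p.2 l) -
          zmodChar (zmodPairing p.2 k) * zmodChar (zmodPairing p.2 l)) *
            dft f p.1 * dft f p.2 := by
    unfold collOpC
    simp_rw [dft_sum, dft_const_mul, dft_sub, add_assoc]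
    refine Finset.sum_congr rfl fun k _ => Finset.sum_congr rfl fun l _ => ?_
    rw [dft_mul (fun i => f (i + k)), dft_mul f, ← Finset.sum_sub_distrib]
    congr 1
    refine Finset.sum_congr rfl fun p _ => ?_
    rw [dft_comp_add_right, dft_comp_add_right, dft_comp_add_right, zmodPairing_add_right,
      zmodChar_add]
    ring
  rw [hsum]
  simp_rw [Finset.mul_sum]
  rw [Finset.sum_congr rfl fun k _ => Finset.sum_comm, Finset.sum_comm]
  refine Finset.sum_congr rfl fun p _ => ?_
  simp only [kernelMode, ← Finset.sum_sub_distrib, Finset.sum_mul]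
  refine Finset.sum_congr rfl fun k _ => Finset.sum_congr rfl fun l _ => ?_
  ring
end
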